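/- Let k be a commutative ring and I an index set. Let a : I → I → ℤ be a symmetric function with a i i = 2 for all i and a i j ∈ {0, −1} for i ≠ j, and let v : I → I → kˣ be invertible scalars with (v i j)·(v j i) = 1 whenever a i j = −1. Define c : I → I → k by c j i = 2 if j = i, c j i = v j i if a i j = −1, and c j i = 0 if a i j = 0 with i ≠ j. Let M be the free k-module with basis (b_j)_{j∈I} and for each i ∈ I let σ_i : M → M be the k-linear map with σ_i(b_j) = b_j − (c j i)·b_i. Define the Coxeter matrix m on I by m(i,i) = 1, m(i,j) = 2 if a i j = 0 (i ≠ j), and m(i,j) = 3 if a i j = −1, and let W be the associated Coxeter group with simple generators (s_i)_{i∈I}. Then there is a group homomorphism from W to the group of k-linear automorphisms of M sending each simple generator s_i to σ_i. -/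

import Mathlib

/-- The linear map on the free module `I →₀ k` sending the basis vector `b_j` to
`b_j − (c j i) • b_i`. -/
noncomputable def bubbleReflection {k : Type*} [CommRing k] {I : Type*}
    (c : I → I → k) (i : I) : (I →₀ k) →ₗ[k] (I →₀ k) :=
  Finsupp.linearCombination k fun j => Finsupp.single j 1 - c j i • Finsupp.single i 1

section BubbleReflection

variable {k : Type*} [CommRing k] {I : Type*} {c : I → I → k} {i j : I}

theorem bubbleReflection_single (c : I → I → k) (i j : I) :
    bubbleReflection c i (Finsupp.single j 1) =
      Finsupp.single j 1 - c j i • Finsupp.single i 1 := by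
  simp [bubbleReflection]

theorem bubbleReflection_mul_self (hi : c i i = 2) :
    bubbleReflection c i * bubbleReflection c i = 1 := by
  ext1 x
  refine LinearMap.ext_ring ?_
  simp only [LinearMap.comp_apply, Finsupp.lsingle_apply, Module.End.mul_apply,
    Module.End.one_apply, bubbleReflection_single, map_sub, map_smul, hi]
  module

theorem bubbleReflection_mul_comm (hij : c i j = 0) (hji : c j i = 0) :
    bubbleReflection c i * bubbleReflection c j =
      bubbleReflection c j * bubbleReflection c i := by
  ext1 x
  refine LinearMap.ext_ring ?_
  simp only [LinearMap.comp_apply, Finsupp.lsingle_apply, Module.End.mul_apply,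
    bubbleReflection_single, map_sub, map_smul, hij, hji]
  module

theorem bubbleReflection_braid (hi : c i i = 2) (hj : c j j = 2) (h : c i j * c j i = 1) :
    bubbleReflection c i * bubbleReflection c j * bubbleReflection c i =
      bubbleReflection c j * bubbleReflection c i * bubbleReflection c j := by
  ext1 x
  refine LinearMap.ext_ring ?_
  simp only [LinearMap.comp_apply, Finsupp.lsingle_apply, Module.End.mul_apply,
    bubbleReflection_single, map_sub, map_smul, hi, hj]
  match_scalars
  · ring
  · linear_combination -c x i * h
  · linear_combination c x j * h

end BubbleReflection

/-- For a simply-laced symmetric Cartan datum `a` with edge scalars `v` satisfying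
`v i j · v j i = 1` on edges, the assignment `s_i ↦ σ_i`, where
`σ_i(b_j) = b_j − (c j i)·b_i` with `c i i = 2`, `c j i = v j i` on edges and `c j i = 0`
otherwise, extends to a group homomorphism from the Coxeter group `W` of the
Coxeter matrix `m` (with `m i i = 1`, `m i j = 2` if `a i j = 0` and `m i j = 3`
if `a i j = −1`) to the group of `k`-linear automorphisms of the free module on the `b_j`. -/
theorem weyl_action_on_bubbles {k : Type*} [CommRing k] {I : Type*} [DecidableEq I]
    (a : I → I → ℤ) (v : I → I → kˣ) (c : I → I → k)
    (ha_symm : ∀ i j, a i j = a j i)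
    (ha_diag : ∀ i, a i i = 2)
    (ha_off : ∀ i j, i ≠ j → a i j = 0 ∨ a i j = -1)
    (hv : ∀ i j, a i j = -1 → (v i j : k) * (v j i : k) = 1)
    (hc_diag : ∀ i, c i i = 2)
    (hc_edge : ∀ i j, a i j = -1 → c j i = (v j i : k))
    (hc_orth : ∀ i j, i ≠ j → a i j = 0 → c j i = 0)
    (m : CoxeterMatrix I)
    (hm : ∀ i j : I, m i j = if i = j then 1 else if a i j = 0 then 2 else 3) :
    ∃ ρ : m.Group →* (Module.End k (I →₀ k))ˣ,
      ∀ i : I, (ρ (m.simple i) : Module.End k (I →₀ k)) = bubbleReflection c i := by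
  have hsq (i : I) := bubbleReflection_mul_self (hc_diag i)
  have hlift : m.IsLiftable (bubbleReflection c) := by
    intro i j
    rw [hm]
    split_ifs with hij h0
    · rw [← hij, pow_one, hsq]
    · have hcomm := bubbleReflection_mul_comm (hc_orth j i (Ne.symm hij) (ha_symm i j ▸ h0))
        (hc_orth i j hij h0)
      rw [pow_two]
      nth_rw 2 [hcomm]
      rw [mul_assoc, ← mul_assoc (bubbleReflection c j), hsq, one_mul, hsq]
    · have hedge := (ha_off i j hij).resolve_left h0
      have hbraid := bubbleReflection_braid (hc_diag i) (hc_diag j) (by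
        rw [hc_edge i j hedge, hc_edge j i (ha_symm i j ▸ hedge), hv i j hedge])
      calc (bubbleReflection c i * bubbleReflection c j) ^ 3
          = bubbleReflection c i * bubbleReflection c j * bubbleReflection c i *
              (bubbleReflection c j * bubbleReflection c i * bubbleReflection c j) := by
            simp only [pow_succ, pow_zero, one_mul, mul_assoc]
        _ = bubbleReflection c i * (bubbleReflection c j *
              (bubbleReflection c i * bubbleReflection c i) * bubbleReflection c j) *
              bubbleReflection c i := by
            rw [← hbraid]
            simp only [mul_assoc]
        _ = 1 := by rw [hsq, mul_one, hsq, mul_one, hsq]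
  let f := m.toCoxeterSystem.lift ⟨bubbleReflection c, hlift⟩
  exact ⟨f.toHomUnits, fun i => m.toCoxeterSystem.lift_apply_simple hlift i⟩
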